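/- Let m ≥ 2 and let P^M be the MERW transition matrix on the rose graph R_m^4: from the hub, probability 1/(2m) to each internal node; from each internal node, probability m/(m+1) to the hub and 1/(m+1) to its peripheral neighbor; from each peripheral node, probability 1/2 to each of its two internal neighbors. Suppose h : {0,1,…,3m} → ℝ satisfies h(0) = 0 and h(i) = 1 + Σ_j P^M(i,j)·h(j) for every vertex i ≠ 0. Then h(i) = (m+2)/m for every internal node i, h(j) = 2(m+1)/m for every peripheral node j, and the partial mean hitting time to the hub equals T_H^M = (1/(3m))·Σ_{i≠0} h(i) = 4/3 + 2/m. -/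

import Mathlib

open Finset
/-- Transition matrix of the maximal entropy random walk (MERW) on the rose graph
`R_m^4`: from the hub (vertex `0`) probability `1/(2m)` to each internal node; from each
internal node probability `m/(m+1)` to the hub and `1/(m+1)` to its peripheral neighbor;
from each peripheral node probability `1/2` to each of its two internal neighbors. -/
noncomputable def rosePM (m : ℕ) : Matrix (Fin (3 * m + 1)) (Fin (3 * m + 1)) ℝ :=
  fun i j =>
    if (i : ℕ) = 0 ∧ (j : ℕ) % 3 ≠ 0 then 1 / (2 * (m : ℝ))
    else if (i : ℕ) % 3 ≠ 0 ∧ (j : ℕ) = 0 then (m : ℝ) / ((m : ℝ) + 1)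
    else if ((i : ℕ) % 3 = 1 ∧ (j : ℕ) = (i : ℕ) + 2)
        ∨ ((i : ℕ) % 3 = 2 ∧ (j : ℕ) = (i : ℕ) + 1) then 1 / ((m : ℝ) + 1)
    else if (i : ℕ) % 3 = 0 ∧ (i : ℕ) ≠ 0
        ∧ ((j : ℕ) + 2 = (i : ℕ) ∨ (j : ℕ) + 1 = (i : ℕ)) then 1 / 2
    else 0

/-- From an internal node the walk moves to the hub or to the peripheral neighbor `k`. -/
lemma rosePM_sum_internal (m : ℕ) (h : Fin (3 * m + 1) → ℝ) (i k : Fin (3 * m + 1))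
    (hik : ((i : ℕ) % 3 = 1 ∧ (k : ℕ) = i + 2) ∨ ((i : ℕ) % 3 = 2 ∧ (k : ℕ) = i + 1)) :
    ∑ j, rosePM m i j * h j
      = (m : ℝ) / ((m : ℝ) + 1) * h 0 + 1 / ((m : ℝ) + 1) * h k := by
  have hi : (i : ℕ) % 3 ≠ 0 := by omega
  have hi0 : (i : ℕ) ≠ 0 := by omega
  have hk0 : (k : ℕ) ≠ 0 := by omega
  rw [Fintype.sum_eq_add 0 k (fun e => hk0 (by simp [← e]))]
  · simp [rosePM, hi, hi0, hk0, hik]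
  · rintro x ⟨hx0, hxk⟩
    have hx0' : (x : ℕ) ≠ 0 := fun e => hx0 (Fin.ext e)
    have hxk' : (x : ℕ) ≠ k := fun e => hxk (Fin.ext e)
    have hx : ¬(((i : ℕ) % 3 = 1 ∧ (x : ℕ) = i + 2) ∨ ((i : ℕ) % 3 = 2 ∧ (x : ℕ) = i + 1)) := by
      omega
    simp only [rosePM, hi0, hx0', hx, hi, false_and, and_false, if_false, zero_mul]

/-- From a peripheral node the walk moves to either of its internal neighbors. -/
lemma rosePM_sum_peripheral (m : ℕ) (h : Fin (3 * m + 1) → ℝ) (i a b : Fin (3 * m + 1))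
    (hi : (i : ℕ) % 3 = 0) (ha : (a : ℕ) + 2 = i) (hb : (b : ℕ) + 1 = i) :
    ∑ j, rosePM m i j * h j = 1 / 2 * h a + 1 / 2 * h b := by
  have hi0 : (i : ℕ) ≠ 0 := by omega
  have row (x : Fin (3 * m + 1)) :
      rosePM m i x = if (x : ℕ) + 2 = i ∨ (x : ℕ) + 1 = i then 1 / 2 else 0 := by
    simp [rosePM, hi, hi0]
  rw [Fintype.sum_eq_add a b (fun e => by subst e; omega)]
  · rw [row, row, if_pos (Or.inl ha), if_pos (Or.inr hb)]
  · rintro x ⟨hxa, hxb⟩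
    rw [Ne, Fin.ext_iff] at hxa hxb
    rw [row, if_neg (by omega), zero_mul]

/-- Summing a function that is `a` on internal labels and `b` on peripheral labels. -/
lemma sum_range_internal_peripheral (a b : ℝ) (m : ℕ) :
    ∑ n ∈ Finset.range (3 * m + 1), (if n = 0 then 0 else if n % 3 = 0 then b else a)
      = m * (2 * a + b) := by
  induction m with
  | zero => simp
  | succ k ih =>
    rw [show 3 * (k + 1) + 1 = 3 * k + 1 + 1 + 1 + 1 by ring, Finset.sum_range_succ,
      Finset.sum_range_succ, Finset.sum_range_succ, ih]
    have h1 : (3 * k + 1) % 3 ≠ 0 := by omega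
    have h2 : (3 * k + 1 + 1) % 3 ≠ 0 := by omega
    have h3 : (3 * k + 1 + 1 + 1) % 3 = 0 := by omega
    rw [if_neg (by omega), if_neg h1, if_neg (by omega), if_neg h2, if_neg (by omega), if_pos h3]
    push_cast
    ring

/-- Mean hitting time to the hub for the MERW on the rose graph `R_m^4`: the solution of
the first-step equations equals `(m+2)/m` at every internal node and `2(m+1)/m` at every
peripheral node, and the partial mean hitting time to the hub is `4/3 + 2/m`. -/
theorem rose_merw_hitting_hub (m : ℕ) (hm : 2 ≤ m)
    (h : Fin (3 * m + 1) → ℝ)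
    (h0 : h 0 = 0)
    (hstep : ∀ i : Fin (3 * m + 1), i ≠ 0 → h i = 1 + ∑ j, rosePM m i j * h j) :
    (∀ i : Fin (3 * m + 1), (i : ℕ) % 3 ≠ 0 → h i = ((m : ℝ) + 2) / (m : ℝ)) ∧
      (∀ i : Fin (3 * m + 1), (i : ℕ) % 3 = 0 → (i : ℕ) ≠ 0 →
        h i = 2 * ((m : ℝ) + 1) / (m : ℝ)) ∧
      (1 / (3 * (m : ℝ)))
          * ∑ i ∈ Finset.univ.filter (fun i : Fin (3 * m + 1) => i ≠ 0), h i
        = 4 / 3 + 2 / (m : ℝ) := by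
  have hm0 : (m : ℝ) ≠ 0 := by
    have : m ≠ 0 := by omega
    exact_mod_cast this
  have hm1 : (m : ℝ) + 1 ≠ 0 := by positivity
  have internal (i k : Fin (3 * m + 1))
      (hik : ((i : ℕ) % 3 = 1 ∧ (k : ℕ) = i + 2) ∨ ((i : ℕ) % 3 = 2 ∧ (k : ℕ) = i + 1)) :
      h i = 1 + 1 / ((m : ℝ) + 1) * h k := by
    have hi : i ≠ 0 := by
      rintro rfl
      simp at hik
    rw [hstep i hi, rosePM_sum_internal m h i k hik, h0, mul_zero, zero_add]
  have hper : ∀ i : Fin (3 * m + 1), (i : ℕ) % 3 = 0 → (i : ℕ) ≠ 0 →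
      h i = 2 * ((m : ℝ) + 1) / (m : ℝ) := by
    intro i hi hi0
    have hlt := i.isLt
    let a : Fin (3 * m + 1) := ⟨i - 2, by omega⟩
    let b : Fin (3 * m + 1) := ⟨i - 1, by omega⟩
    have ha : (a : ℕ) + 2 = i := by simp only [a]; omega
    have hb : (b : ℕ) + 1 = i := by simp only [b]; omega
    have key := hstep i (fun e => hi0 (by simp [e]))
    rw [rosePM_sum_peripheral m h i a b hi ha hb, internal a i (by omega),
      internal b i (by omega)] at key
    field_simp at key ⊢
    linarith
  have hint : ∀ i : Fin (3 * m + 1), (i : ℕ) % 3 ≠ 0 → h i = ((m : ℝ) + 2) / (m : ℝ) := by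
    intro i hi
    have hlt := i.isLt
    obtain ⟨k, hik⟩ : ∃ k : Fin (3 * m + 1),
        ((i : ℕ) % 3 = 1 ∧ (k : ℕ) = i + 2) ∨ ((i : ℕ) % 3 = 2 ∧ (k : ℕ) = i + 1) := by
      rcases (by omega : (i : ℕ) % 3 = 1 ∨ (i : ℕ) % 3 = 2) with h1 | h2
      · exact ⟨⟨i + 2, by omega⟩, Or.inl ⟨h1, rfl⟩⟩
      · exact ⟨⟨i + 1, by omega⟩, Or.inr ⟨h2, rfl⟩⟩
    rw [internal i k hik, hper k (by omega) (by omega)]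
    field_simp
  refine ⟨hint, hper, ?_⟩
  have hsum : ∑ i ∈ Finset.univ.filter (fun i : Fin (3 * m + 1) => i ≠ 0), h i
      = m * (2 * (((m : ℝ) + 2) / m) + 2 * ((m : ℝ) + 1) / m) := by
    rw [← sum_range_internal_peripheral, ← Fin.sum_univ_eq_sum_range
      (fun n => if n = 0 then 0 else if n % 3 = 0 then 2 * ((m : ℝ) + 1) / m
        else ((m : ℝ) + 2) / m), Finset.sum_filter]
    refine Finset.sum_congr rfl fun i _ => ?_
    by_cases hi0 : i = 0
    · simp [hi0]
    · have hi0' : (i : ℕ) ≠ 0 := fun e => hi0 (Fin.ext e)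
      rw [if_pos hi0, if_neg hi0']
      split_ifs with hi
      · exact hper i hi hi0'
      · exact hint i hi
  rw [hsum]
  field_simp
  ring
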